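/- Let G be a finite group, N a normal subgroup of G with α(G) = α(G/N), and K any subgroup of G. Then α(K) = α(K/(K ∩ N)). -/

import Mathlib

open scoped Classical

/-- The number of cyclic subgroups of a group. -/
noncomputable def numCyclic (G : Type*) [Group G] : ℕ :=
  Nat.card {H : Subgroup G // IsCyclic (↥H)}

/-- `alpha G = c(G) / |G|`, the number of cyclic subgroups divided by the order. -/
noncomputable def alpha (G : Type*) [Group G] : ℚ :=
  (numCyclic G : ℚ) / (Nat.card G : ℚ)

/-- A finite cyclic subgroup `H` has `φ(|H|)` generators. -/
theorem card_filter_zpowers_eq {G : Type*} [Group G] [Fintype G] (H : Subgroup G)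
    [IsCyclic H] :
    (Finset.univ.filter fun g : G => Subgroup.zpowers g = H).card = (Nat.card H).totient := by
  rw [Nat.card_eq_fintype_card, ← IsCyclic.card_orderOf_eq_totient (α := H) dvd_rfl]
  symm
  refine Finset.card_bij (fun a _ => (a : G)) ?_ (fun _ _ _ _ hab => Subtype.ext hab) ?_
  · intro a ha
    simp only [Finset.mem_filter, Finset.mem_univ, true_and] at ha ⊢
    refine Subgroup.eq_of_le_of_card_ge (by simp) ?_
    rw [Nat.card_zpowers, Subgroup.orderOf_coe, ha, Nat.card_eq_fintype_card]
  · intro g hg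
    simp only [Finset.mem_filter, Finset.mem_univ, true_and] at hg
    refine ⟨⟨g, hg ▸ Subgroup.mem_zpowers g⟩, ?_, rfl⟩
    simp only [Finset.mem_filter, Finset.mem_univ, true_and]
    rw [Subgroup.orderOf_mk, ← Nat.card_zpowers, hg, Nat.card_eq_fintype_card]

theorem numCyclic_eq_sum (G : Type*) [Group G] [Fintype G] :
    (numCyclic G : ℚ) = ∑ g : G, ((orderOf g).totient : ℚ)⁻¹ := by
  rw [← Finset.sum_fiberwise Finset.univ
    (fun g : G => (⟨Subgroup.zpowers g, inferInstance⟩ : {H : Subgroup G // IsCyclic H})),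
    numCyclic, Nat.card_eq_fintype_card, ← Finset.card_univ, Finset.cast_card]
  refine Finset.sum_congr rfl ?_
  rintro ⟨H, hH⟩ -
  have hterm : ∀ g ∈ Finset.univ.filter (fun g : G =>
      (⟨Subgroup.zpowers g, inferInstance⟩ : {H : Subgroup G // IsCyclic H}) = ⟨H, hH⟩),
      ((orderOf g).totient : ℚ)⁻¹ = ((Nat.card H).totient : ℚ)⁻¹ := by
    intro g hg
    simp only [Finset.mem_filter, Finset.mem_univ, true_and, Subtype.mk.injEq] at hg
    rw [← Nat.card_zpowers, hg]
  rw [Finset.sum_congr rfl hterm]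
  simp only [Subtype.mk.injEq, Finset.sum_const, card_filter_zpowers_eq, nsmul_eq_mul]
  refine (mul_inv_cancel₀ ?_).symm
  exact_mod_cast (Nat.totient_pos.2 Nat.card_pos).ne'

theorem sum_quotient_mk {G : Type*} [Group G] [Fintype G] (N : Subgroup G) (f : G ⧸ N → ℚ) :
    ∑ g : G, f g = Nat.card N * ∑ q : G ⧸ N, f q := by
  rw [← Finset.sum_fiberwise' Finset.univ (QuotientGroup.mk : G → G ⧸ N) f, Finset.mul_sum]
  refine Finset.sum_congr rfl fun q _ => ?_
  have hcard := QuotientGroup.card_preimage_mk N {q}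
  rw [Nat.card_eq_fintype_card, Fintype.card_subtype] at hcard
  simp only [Set.mem_preimage, Set.mem_singleton_iff, Nat.card_unique, mul_one] at hcard
  rw [Finset.sum_const, hcard, nsmul_eq_mul]

theorem alpha_quotient_eq_sum {G : Type*} [Group G] [Fintype G] (N : Subgroup G) [N.Normal] :
    alpha (G ⧸ N) =
      (∑ g : G, ((orderOf (g : G ⧸ N)).totient : ℚ)⁻¹) / (Nat.card G : ℚ) := by
  have hN : (Nat.card N : ℚ) ≠ 0 := by exact_mod_cast Nat.card_pos.ne'
  rw [sum_quotient_mk N fun q => ((orderOf q).totient : ℚ)⁻¹, alpha, numCyclic_eq_sum,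
    N.card_eq_card_quotient_mul_card_subgroup, Nat.cast_mul, mul_comm (Nat.card (G ⧸ N) : ℚ),
    mul_div_mul_left _ _ hN]

theorem alpha_eq_alpha_quotient_iff {G : Type*} [Group G] [Fintype G] (N : Subgroup G)
    [N.Normal] :
    alpha G = alpha (G ⧸ N) ↔
      ∀ g : G, (orderOf g).totient = (orderOf (g : G ⧸ N)).totient := by
  have hG : (Nat.card G : ℚ) ≠ 0 := by exact_mod_cast Nat.card_pos.ne'
  rw [alpha_quotient_eq_sum, alpha, numCyclic_eq_sum, div_left_inj' hG,
    Finset.sum_eq_sum_iff_of_le]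
  · simp
  · intro g _
    have hpos : 0 < (orderOf (g : G ⧸ N)).totient := Nat.totient_pos.2 (orderOf_pos _)
    have hle : (orderOf (g : G ⧸ N)).totient ≤ (orderOf g).totient :=
      Nat.le_of_dvd (Nat.totient_pos.2 (orderOf_pos _))
        (Nat.totient_dvd_of_dvd (orderOf_map_dvd (QuotientGroup.mk' N) g))
    exact inv_anti₀ (by exact_mod_cast hpos) (by exact_mod_cast hle)

theorem orderOf_mk_subgroupOf {G : Type*} [Group G] (N K : Subgroup G) [N.Normal] (k : K) :
    orderOf (k : K ⧸ N.subgroupOf K) = orderOf ((k : G) : G ⧸ N) := by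
  refine orderOf_eq_orderOf_iff.2 fun n => ?_
  rw [← QuotientGroup.mk_pow, ← QuotientGroup.mk_pow, QuotientGroup.eq_one_iff,
    QuotientGroup.eq_one_iff, Subgroup.mem_subgroupOf, Subgroup.coe_pow]

theorem stmt_7 (G : Type*) [Group G] [Fintype G] (N : Subgroup G) [N.Normal]
    (h : alpha G = alpha (G ⧸ N)) (K : Subgroup G) :
    alpha K = alpha (K ⧸ N.subgroupOf K) := by
  rw [alpha_eq_alpha_quotient_iff] at h ⊢
  intro k
  rw [orderOf_mk_subgroupOf, ← h, Subgroup.orderOf_coe]
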